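/- For every integer k ≥ 0 there is a holomorphic function G_k on ℂ ∖ I_k such that G_k agrees with g_k on ℂ₊, G_k(conj z) = conj(G_k(z)) for all z ∈ ℂ ∖ I_k, and Γ(G_k(x)) = (−1)^{k+1} x for every real x ∉ I_k. -/

import Mathlib

open Complex

/-- The holomorphic branch `L` of `log Γ` on `ℂ ∖ (−∞,0]`:
`L(z) = −γz − Log z − ∑_{k=1}^∞ (Log(1 + z/k) − z/k)`. -/
noncomputable def logGamma (z : ℂ) : ℂ :=
  -(Real.eulerMascheroniConstant : ℂ) * z - Complex.log z -
    ∑' k : ℕ, (Complex.log (1 + z / (k + 1)) - z / (k + 1))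

/-- The interval `I_k`: for odd `k`, `[Γ(x_k), Γ(x_{k+1})]`; for even `k`,
`[−Γ(x_k), −Γ(x_{k+1})]`. -/
noncomputable def Ik (x : ℕ → ℝ) (k : ℕ) : Set ℝ :=
  if Odd k then Set.Icc (Real.Gamma (x k)) (Real.Gamma (x (k + 1)))
  else Set.Icc (-Real.Gamma (x k)) (-Real.Gamma (x (k + 1)))

open Filter Topology

theorem norm_logGamma_term_le {z : ℂ} {R : ℝ} {k : ℕ} (hz : ‖z‖ ≤ R) (hk : 2 * R ≤ k) :
    ‖Complex.log (1 + z / (k + 1)) - z / (k + 1)‖ ≤ R ^ 2 / ((k : ℝ) + 1) ^ 2 := by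
  have hk0 : (0 : ℝ) < (k : ℝ) + 1 := by positivity
  have hn : ‖z / ((k : ℂ) + 1)‖ = ‖z‖ / ((k : ℝ) + 1) := by
    rw [norm_div]
    congr 1
    exact_mod_cast Complex.norm_natCast (k + 1)
  have hhalf : ‖z / ((k : ℂ) + 1)‖ ≤ 1 / 2 := by
    rw [hn, div_le_div_iff₀ hk0 two_pos]
    linarith
  have hinv : (1 - ‖z / ((k : ℂ) + 1)‖)⁻¹ ≤ 2 := by
    rw [inv_le_comm₀ (by linarith) two_pos]
    linarith
  calc _ ≤ ‖z / ((k : ℂ) + 1)‖ ^ 2 * (1 - ‖z / ((k : ℂ) + 1)‖)⁻¹ / 2 :=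
        Complex.norm_log_one_add_sub_self_le (by linarith)
    _ ≤ ‖z / ((k : ℂ) + 1)‖ ^ 2 * 2 / 2 := by gcongr
    _ = ‖z‖ ^ 2 / ((k : ℝ) + 1) ^ 2 := by rw [hn, div_pow]; ring
    _ ≤ _ := by gcongr

theorem summable_div_succ_sq (R : ℝ) : Summable fun k : ℕ => R ^ 2 / ((k : ℝ) + 1) ^ 2 := by
  have h := (summable_nat_add_iff 1).2 (Real.summable_one_div_nat_pow.2 one_lt_two)
  simpa [div_eq_mul_inv] using h.mul_left (R ^ 2)

theorem summable_logGamma_term (z : ℂ) :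
    Summable fun k : ℕ => Complex.log (1 + z / (k + 1)) - z / (k + 1) := by
  refine Summable.of_norm_bounded_eventually (summable_div_succ_sq ‖z‖) ?_
  rw [Nat.cofinite_eq_atTop]
  filter_upwards [eventually_ge_atTop ⌈2 * ‖z‖⌉₊] with k hk
  exact norm_logGamma_term_le le_rfl (Nat.ceil_le.1 hk)

theorem exp_logGamma {z : ℂ} (hz : ∀ m : ℕ, z ≠ -m) :
    Complex.exp (logGamma z) = Complex.Gamma z := by
  have hne : ∀ m : ℕ, z + m ≠ 0 := fun m h => hz m (eq_neg_of_add_eq_zero_left h)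
  have hsum := (summable_logGamma_term z).hasSum.tendsto_sum_nat
  have hlim : Tendsto (fun n : ℕ => Complex.exp (-(Real.eulerMascheroniConstant : ℂ) * z -
      Complex.log z - ∑ k ∈ Finset.range n, (Complex.log (1 + z / (k + 1)) - z / (k + 1))))
      atTop (𝓝 (Complex.exp (logGamma z))) :=
    (Complex.continuous_exp.tendsto _).comp (hsum.const_sub _)
  have hharm : Tendsto (fun n : ℕ => Complex.exp
      (((((harmonic n : ℚ) : ℝ) - Real.log n : ℝ) : ℂ) * z -
        (Real.eulerMascheroniConstant : ℂ) * z)) atTop (𝓝 1) := by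
    have h := (Complex.continuous_ofReal.tendsto _).comp Real.tendsto_harmonic_sub_log
    have h2 := (Complex.continuous_exp.tendsto _).comp
      ((h.mul_const z).sub_const ((Real.eulerMascheroniConstant : ℂ) * z))
    simpa [Function.comp_def] using h2
  have hprod := hharm.mul (Complex.GammaSeq_tendsto_Gamma z)
  rw [one_mul] at hprod
  refine tendsto_nhds_unique hlim (hprod.congr' ?_)
  filter_upwards [eventually_ge_atTop 1] with n hn
  have hterm : ∀ k ∈ Finset.range n, Complex.exp (Complex.log (1 + z / (k + 1))) =
      (z + (k + 1 : ℕ)) / ((k + 1 : ℕ) : ℂ) := by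
    intro k _
    have hk : ((k : ℂ) + 1) ≠ 0 := by exact_mod_cast k.succ_ne_zero
    have h1 := hne (k + 1)
    have heq : 1 + z / ((k : ℂ) + 1) = (z + (k + 1 : ℕ)) / ((k + 1 : ℕ) : ℂ) := by
      push_cast
      field_simp
      ring
    rw [heq, Complex.exp_log]
    exact div_ne_zero h1 (by exact_mod_cast k.succ_ne_zero)
  have hfact : ∏ k ∈ Finset.range n, ((k + 1 : ℕ) : ℂ) = (n.factorial : ℂ) := by
    rw [← Finset.prod_range_add_one_eq_factorial]
    push_cast
    rfl
  have hh : ((harmonic n : ℚ) : ℂ) * z = ∑ k ∈ Finset.range n, z / ((k : ℂ) + 1) := by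
    rw [mul_comm]
    simp [harmonic, Finset.mul_sum, div_eq_mul_inv]
  have hz0 : z ≠ 0 := by simpa using hz 0
  have hn0 : (n : ℂ) ≠ 0 := by exact_mod_cast (by omega : n ≠ 0)
  rw [Finset.sum_sub_distrib, ← hh]
  have hR : Complex.exp (-(Real.eulerMascheroniConstant : ℂ) * z - Complex.log z -
      (∑ k ∈ Finset.range n, Complex.log (1 + z / (k + 1)) - ((harmonic n : ℚ) : ℂ) * z)) =
      Complex.exp (((harmonic n : ℚ) : ℂ) * z - (Real.eulerMascheroniConstant : ℂ) * z) *
        (z * ((∏ k ∈ Finset.range n, (z + (k + 1 : ℕ))) / n.factorial))⁻¹ := by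
    rw [← hfact, ← Finset.prod_div_distrib, ← Finset.prod_congr rfl hterm, ← Complex.exp_sum]
    have hmul : ∀ w : ℂ, z * Complex.exp w = Complex.exp (Complex.log z + w) := fun w => by
      rw [Complex.exp_add, Complex.exp_log hz0]
    rw [hmul, ← Complex.exp_neg, ← Complex.exp_add]
    congr 1
    ring
  rw [hR, Complex.GammaSeq, Finset.prod_range_succ', Complex.cpow_def_of_ne_zero hn0]
  have hL : Complex.exp (((((harmonic n : ℚ) : ℝ) - Real.log n : ℝ) : ℂ) * z -
        (Real.eulerMascheroniConstant : ℂ) * z) * Complex.exp (Complex.log n * z) =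
      Complex.exp (((harmonic n : ℚ) : ℂ) * z - (Real.eulerMascheroniConstant : ℂ) * z) := by
    rw [← Complex.exp_add, ← Complex.natCast_log]
    congr 1
    push_cast
    ring
  rw [← hL]
  simp only [Nat.cast_zero, add_zero]
  rw [mul_inv, inv_div]
  ring

theorem im_slope_log_neg {a b : ℂ} (ha : 0 < a.im) (hb : 0 < b.im) (hab : a ≠ b) :
    ((Complex.log a - Complex.log b) / (a - b)).im < 0 := by
  have hab' : a - b ≠ 0 := sub_ne_zero.2 hab
  have him : ∀ t ∈ Set.Icc (0 : ℝ) 1, 0 < (b + t * (a - b)).im := by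
    intro t ht
    simp only [add_im, mul_im, ofReal_re, ofReal_im, sub_im, zero_mul, add_zero]
    rcases ht.1.eq_or_lt with h | h
    · rw [← h]; linarith
    · nlinarith [mul_pos h ha, mul_nonneg (sub_nonneg.2 ht.2) hb.le]
  have hder : ∀ t ∈ Set.Icc (0 : ℝ) 1, HasDerivAt
      (fun t : ℝ => (Complex.log (b + t * (a - b)) / (a - b)).im)
      ((b + t * (a - b))⁻¹).im t := by
    intro t ht
    have h1 : HasDerivAt (fun t : ℝ => b + (t : ℂ) * (a - b)) (a - b) t := by
      simpa using (((hasDerivAt_id t).ofReal_comp).mul_const (a - b)).const_add b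
    have h2 := (h1.clog_real (Or.inr (him t ht).ne')).div_const (a - b)
    rw [div_right_comm, div_self hab', one_div] at h2
    exact Complex.imCLM.hasFDerivAt.comp_hasDerivAt t h2
  have hanti : StrictAntiOn (fun t : ℝ => (Complex.log (b + t * (a - b)) / (a - b)).im)
      (Set.Icc 0 1) := by
    refine strictAntiOn_of_deriv_neg (convex_Icc 0 1)
      (fun t ht => (hder t ht).continuousAt.continuousWithinAt) fun t ht => ?_
    have ht' := interior_subset ht
    rw [(hder t ht').deriv, Complex.inv_im]
    have hpos := him t ht'
    refine div_neg_of_neg_of_pos (neg_lt_zero.2 hpos) (Complex.normSq_pos.2 fun h => ?_)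
    rw [h] at hpos
    simp at hpos
  have := hanti (Set.left_mem_Icc.2 zero_le_one) (Set.right_mem_Icc.2 zero_le_one) zero_lt_one
  simp only [ofReal_one, one_mul, ofReal_zero, zero_mul, add_zero, add_sub_cancel] at this
  rw [sub_div, sub_im]
  linarith

theorem logGamma_injOn : Set.InjOn logGamma {z : ℂ | 0 < z.im} := by
  intro a (ha : 0 < a.im) b (hb : 0 < b.im) h
  by_contra hab
  have hab' : a - b ≠ 0 := sub_ne_zero.2 hab
  have hs := ((summable_logGamma_term a).sub (summable_logGamma_term b)).div_const (a - b)
  have hts := ((summable_logGamma_term a).tsum_sub (summable_logGamma_term b))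
  have hterm : ∀ k : ℕ, (((Complex.log (1 + a / (k + 1)) - a / (k + 1)) -
      (Complex.log (1 + b / (k + 1)) - b / (k + 1))) / (a - b)).im ≤ 0 := by
    intro k
    have hk : (0 : ℝ) < (k : ℝ) + 1 := by positivity
    have hk' : ((k : ℂ) + 1) = (((k : ℝ) + 1 : ℝ) : ℂ) := by push_cast; rfl
    have hkne : ((k : ℂ) + 1) ≠ 0 := by exact_mod_cast k.succ_ne_zero
    have himdiv : ∀ c : ℂ, 0 < c.im → 0 < (1 + c / ((k : ℂ) + 1)).im := by
      intro c hc
      rw [hk', add_im, one_im, Complex.div_ofReal_im]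
      have := div_pos hc hk
      linarith
    have hne : 1 + a / ((k : ℂ) + 1) ≠ 1 + b / ((k : ℂ) + 1) := by
      intro h
      exact hab ((div_left_inj' hkne).1 (add_left_cancel h))
    have hlog := im_slope_log_neg (himdiv a ha) (himdiv b hb) hne
    have heq : ((Complex.log (1 + a / (k + 1)) - a / (k + 1)) -
        (Complex.log (1 + b / (k + 1)) - b / (k + 1))) / (a - b) =
        ((Complex.log (1 + a / (k + 1)) - Complex.log (1 + b / (k + 1))) /
          ((1 + a / ((k : ℂ) + 1)) - (1 + b / ((k : ℂ) + 1)))) / (((k : ℝ) + 1 : ℝ) : ℂ) -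
        ((1 / ((k : ℝ) + 1) : ℝ) : ℂ) := by
      rw [← hk', show (1 + a / ((k : ℂ) + 1)) - (1 + b / ((k : ℂ) + 1)) =
        (a - b) / ((k : ℂ) + 1) by ring]
      push_cast
      field_simp
      ring
    rw [heq, sub_im, ofReal_im, Complex.div_ofReal_im, sub_zero]
    exact (div_neg_of_neg_of_pos hlog hk).le
  have hsum : ((∑' k : ℕ, ((Complex.log (1 + a / (k + 1)) - a / (k + 1)) -
      (Complex.log (1 + b / (k + 1)) - b / (k + 1)))) / (a - b)).im ≤ 0 := by
    rw [← tsum_div_const, Complex.im_tsum hs]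
    exact tsum_nonpos hterm
  have hlog := im_slope_log_neg ha hb hab
  have heq : (Complex.log a - Complex.log b) / (a - b) = -(Real.eulerMascheroniConstant : ℂ) -
      (∑' k : ℕ, ((Complex.log (1 + a / (k + 1)) - a / (k + 1)) -
      (Complex.log (1 + b / (k + 1)) - b / (k + 1)))) / (a - b) := by
    rw [hts]
    unfold logGamma at h
    rw [eq_sub_iff_add_eq, ← add_div, div_eq_iff hab']
    linear_combination -h
  rw [heq, sub_im, neg_im, ofReal_im] at hlog
  linarith

/-- The component of `ℝ ∖ {0, -1, -2, …}` lying immediately to the right of `-m`. -/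
def gammaCell (m : ℕ) : Set ℝ := {s | (∀ j : ℕ, j < m → s + j < 0) ∧ 0 < s + m}

theorem add_pos_of_mem_gammaCell {m : ℕ} {s : ℝ} (hs : s ∈ gammaCell m) {j : ℕ} (hj : m ≤ j) :
    0 < s + j := by
  have h := hs.2
  have : (m : ℝ) ≤ j := by exact_mod_cast hj
  linarith

theorem add_ne_zero_of_mem_gammaCell {m : ℕ} {s : ℝ} (hs : s ∈ gammaCell m) (j : ℕ) :
    s + j ≠ 0 := by
  rcases lt_or_ge j m with h | h
  · exact (hs.1 j h).ne
  · exact (add_pos_of_mem_gammaCell hs h).ne'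

theorem ne_neg_of_mem_gammaCell {m : ℕ} {s : ℝ} (hs : s ∈ gammaCell m) (j : ℕ) : s ≠ -j :=
  fun h => add_ne_zero_of_mem_gammaCell hs j (by linarith)

theorem ofReal_ne_neg_of_mem_gammaCell {m : ℕ} {s : ℝ} (hs : s ∈ gammaCell m) (j : ℕ) :
    (s : ℂ) ≠ -j := by
  intro h
  exact ne_neg_of_mem_gammaCell hs j (by exact_mod_cast h)

theorem ordConnected_gammaCell (m : ℕ) : (gammaCell m).OrdConnected := by
  refine ⟨fun a ha b hb c hc => ⟨fun j hj => ?_, ?_⟩⟩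
  · linarith [hb.1 j hj, hc.2]
  · linarith [ha.2, hc.1]

theorem one_add_div_succ_eq (s : ℝ) (j : ℕ) :
    1 + s / ((j : ℝ) + 1) = (s + (j + 1 : ℕ)) / ((j : ℝ) + 1) := by
  have : (0 : ℝ) < (j : ℝ) + 1 := by positivity
  push_cast
  field_simp
  ring

theorem one_add_div_succ_ofReal (s : ℝ) (j : ℕ) :
    1 + (s : ℂ) / ((j : ℂ) + 1) = ((1 + s / ((j : ℝ) + 1) : ℝ) : ℂ) := by
  push_cast
  rfl

theorem continuousWithinAt_log_ofReal {t : ℝ} (ht : t ≠ 0) :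
    ContinuousWithinAt Complex.log {z : ℂ | 0 ≤ z.im} (t : ℂ) := by
  rcases ht.lt_or_gt with h | h
  · exact Complex.continuousWithinAt_log_of_re_neg_of_im_zero (by simpa using h) (by simp)
  · exact (continuousAt_clog (Or.inl (by simpa using h))).continuousWithinAt

theorem continuousWithinAt_logGamma {m : ℕ} {s : ℝ} (hs : s ∈ gammaCell m) :
    ContinuousWithinAt logGamma {z : ℂ | 0 ≤ z.im} (s : ℂ) := by
  have hs0 : s ≠ 0 := by simpa using add_ne_zero_of_mem_gammaCell hs 0
  have hid : Tendsto (fun z : ℂ => z) (𝓝[{z : ℂ | 0 ≤ z.im}] (s : ℂ)) (𝓝 (s : ℂ)) :=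
    tendsto_id.mono_left nhdsWithin_le_nhds
  have hterm : ∀ k : ℕ, Tendsto (fun z : ℂ => Complex.log (1 + z / (k + 1)) - z / (k + 1))
      (𝓝[{z : ℂ | 0 ≤ z.im}] (s : ℂ))
      (𝓝 (Complex.log (1 + (s : ℂ) / (k + 1)) - (s : ℂ) / (k + 1))) := by
    intro k
    refine Tendsto.sub ?_ (hid.div_const _)
    have hk : (0 : ℝ) < (k : ℝ) + 1 := by positivity
    have hne : 1 + s / ((k : ℝ) + 1) ≠ 0 := by
      rw [one_add_div_succ_eq]
      exact div_ne_zero (add_ne_zero_of_mem_gammaCell hs _) hk.ne'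
    have hlog := continuousWithinAt_log_ofReal hne
    rw [← one_add_div_succ_ofReal] at hlog
    refine hlog.tendsto.comp (tendsto_nhdsWithin_iff.2
      ⟨(hid.div_const _).const_add 1, ?_⟩)
    filter_upwards [self_mem_nhdsWithin] with z hz
    have hz : 0 ≤ z.im := hz
    have hcast : ((k : ℂ) + 1) = (((k : ℝ) + 1 : ℝ) : ℂ) := by push_cast; rfl
    change 0 ≤ (1 + z / ((k : ℂ) + 1)).im
    rw [hcast, add_im, one_im, Complex.div_ofReal_im, zero_add]
    positivity
  have hR : ∀ᶠ z : ℂ in 𝓝[{z : ℂ | 0 ≤ z.im}] (s : ℂ), ‖z‖ ≤ ‖(s : ℂ)‖ + 1 :=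
    (hid.norm.eventually_le_const (lt_add_one _))
  set R := ‖(s : ℂ)‖ + 1 with hRdef
  have hsmall : ∀ᶠ z : ℂ in 𝓝[{z : ℂ | 0 ≤ z.im}] (s : ℂ), ∀ k ∈ Finset.range ⌈2 * R⌉₊,
      ‖Complex.log (1 + z / (k + 1)) - z / (k + 1)‖ ≤
        ‖Complex.log (1 + (s : ℂ) / (k + 1)) - (s : ℂ) / (k + 1)‖ + 1 := by
    rw [Finset.eventually_all]
    exact fun k _ => (hterm k).norm.eventually_le_const (lt_add_one _)
  have hbound : Summable fun k : ℕ => if k < ⌈2 * R⌉₊ then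
      ‖Complex.log (1 + (s : ℂ) / (k + 1)) - (s : ℂ) / (k + 1)‖ + 1
      else R ^ 2 / ((k : ℝ) + 1) ^ 2 := by
    refine (summable_congr_cofinite ?_).1 (summable_div_succ_sq R)
    rw [Nat.cofinite_eq_atTop]
    filter_upwards [eventually_ge_atTop ⌈2 * R⌉₊] with k hk
    rw [if_neg (not_lt.2 hk)]
  have htsum := tendsto_tsum_of_dominated_convergence hbound hterm (by
    filter_upwards [hR, hsmall] with z hz hz' k
    split_ifs with hk
    · exact hz' k (Finset.mem_range.2 hk)
    · exact norm_logGamma_term_le hz (Nat.ceil_le.1 (not_lt.1 hk)))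
  exact ((hid.const_mul _).sub (continuousWithinAt_log_ofReal hs0).tendsto).sub htsum

theorem logGamma_im_of_mem_gammaCell {m : ℕ} {s : ℝ} (hs : s ∈ gammaCell m) :
    (logGamma s).im = -(m * Real.pi) := by
  have harg : ∀ t : ℝ, t < 0 → (Complex.log (t : ℂ)).im = Real.pi := fun t ht => by
    rw [Complex.log_im, Complex.arg_ofReal_of_neg ht]
  have harg' : ∀ t : ℝ, 0 < t → (Complex.log (t : ℂ)).im = 0 := fun t ht => by
    rw [Complex.log_im, Complex.arg_ofReal_of_nonneg ht.le]
  have hterm : ∀ k : ℕ, (Complex.log (1 + (s : ℂ) / (k + 1)) - (s : ℂ) / (k + 1)).im =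
      if k + 1 < m then Real.pi else 0 := by
    intro k
    have hk : (0 : ℝ) < (k : ℝ) + 1 := by positivity
    have h0 : ((s : ℂ) / ((k : ℂ) + 1)).im = 0 := by
      rw [show (s : ℂ) / ((k : ℂ) + 1) = ((s / ((k : ℝ) + 1) : ℝ) : ℂ) by push_cast; rfl,
        ofReal_im]
    rw [sub_im, h0, sub_zero, one_add_div_succ_ofReal, one_add_div_succ_eq]
    split_ifs with h
    · exact harg _ (div_neg_of_neg_of_pos (hs.1 _ h) hk)
    · exact harg' _ (div_pos (add_pos_of_mem_gammaCell hs (not_lt.1 h)) hk)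
  have hsum : (∑' k : ℕ, (Complex.log (1 + (s : ℂ) / (k + 1)) - (s : ℂ) / (k + 1))).im =
      ((m - 1 : ℕ) : ℝ) * Real.pi := by
    rw [Complex.im_tsum (summable_logGamma_term s), tsum_congr hterm,
      tsum_eq_sum (s := Finset.range (m - 1))]
    · rw [Finset.sum_congr rfl fun k hk => if_pos
        (by have := Finset.mem_range.1 hk; omega)]
      simp
    · intro k hk
      rw [Finset.mem_range] at hk
      exact if_neg (by omega)
  have hγ : (-(Real.eulerMascheroniConstant : ℂ) * (s : ℂ)).im = 0 := by simp
  unfold logGamma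
  rw [sub_im, sub_im, hsum, hγ]
  rcases Nat.eq_zero_or_pos m with rfl | hm
  · have h := harg' s (by simpa using hs.2)
    simp [h]
  · rw [harg s (by simpa using hs.1 0 hm), Nat.cast_sub hm]
    push_cast
    ring

theorem logGamma_re_of_mem_gammaCell {m : ℕ} {s : ℝ} (hs : s ∈ gammaCell m) :
    (logGamma s).re = Real.log (Real.Gamma s) := by
  have h := exp_logGamma (ofReal_ne_neg_of_mem_gammaCell hs)
  have hn := congrArg norm h
  rw [Complex.norm_exp, Complex.Gamma_ofReal, Complex.norm_real, Real.norm_eq_abs] at hn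
  rw [← Real.log_abs, ← hn, Real.log_exp]

theorem neg_one_pow_mul_Gamma_pos {m : ℕ} {s : ℝ} (hs : s ∈ gammaCell m) :
    0 < (-1 : ℝ) ^ m * Real.Gamma s := by
  have h := exp_logGamma (ofReal_ne_neg_of_mem_gammaCell hs)
  have hL : logGamma s = ((logGamma s).re : ℂ) + ((m : ℤ) : ℂ) * -(Real.pi * I) := by
    apply Complex.ext
    · simp
    · simp [logGamma_im_of_mem_gammaCell hs]
  have hpi : Complex.exp (-(Real.pi * I)) = -1 := by
    rw [Complex.exp_neg, Complex.exp_pi_mul_I]; norm_num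
  rw [hL, Complex.exp_add, Complex.exp_int_mul, hpi, Complex.Gamma_ofReal, zpow_natCast] at h
  have h' : Real.exp (logGamma s).re * (-1 : ℝ) ^ m = Real.Gamma s := by exact_mod_cast h
  rw [← h', mul_left_comm, ← mul_pow]
  simpa using Real.exp_pos _

theorem strictConvexOn_log_Gamma_gammaCell (m : ℕ) :
    StrictConvexOn ℝ (gammaCell m) fun s => Real.log (Real.Gamma s) := by
  have hconv : Convex ℝ (gammaCell m) := (ordConnected_gammaCell m).convex
  have hshift : ∀ j : ℕ, ∀ a ∈ gammaCell m, ∀ b ∈ gammaCell m, a ≠ b → ∀ p q : ℝ, 0 < p → 0 < q →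
      p + q = 1 → p * Real.log (a + j) + q * Real.log (b + j) <
        Real.log (p * a + q * b + j) := by
    intro j a ha b hb hab p q hp hq hpq
    have hab' : a + j ≠ b + j := fun h => hab (add_right_cancel h)
    have heq : p * a + q * b + j = p • (a + (j : ℝ)) + q • (b + (j : ℝ)) := by
      simp only [smul_eq_mul]
      linear_combination (-(j : ℝ)) * hpq
    rw [heq]
    rcases lt_or_ge j m with h | h
    · exact strictConcaveOn_log_Iio.2 (ha.1 j h) (hb.1 j h) hab' hp hq hpq
    · exact strictConcaveOn_log_Ioi.2 (add_pos_of_mem_gammaCell ha h)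
        (add_pos_of_mem_gammaCell hb h) hab' hp hq hpq
  have hterm : ∀ (s : ℝ), s ∈ gammaCell m → ∀ k : ℕ,
      (Complex.log (1 + (s : ℂ) / (k + 1)) - (s : ℂ) / (k + 1)).re =
      Real.log (s + (k + 1 : ℕ)) - Real.log ((k : ℝ) + 1) - s / ((k : ℝ) + 1) := by
    intro s hs k
    rw [sub_re, one_add_div_succ_ofReal, Complex.log_ofReal_re, one_add_div_succ_eq,
      Real.log_div (add_ne_zero_of_mem_gammaCell hs _) (by positivity),
      show (s : ℂ) / ((k : ℂ) + 1) = ((s / ((k : ℝ) + 1) : ℝ) : ℂ) by push_cast; rfl, ofReal_re]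
  have hform : ∀ s ∈ gammaCell m, Real.log (Real.Gamma s) =
      -Real.eulerMascheroniConstant * s - Real.log s -
        ∑' k : ℕ, (Real.log (s + (k + 1 : ℕ)) - Real.log ((k : ℝ) + 1) - s / ((k : ℝ) + 1)) := by
    intro s hs
    rw [← logGamma_re_of_mem_gammaCell hs, logGamma, sub_re, sub_re, Complex.log_ofReal_re,
      Complex.re_tsum (summable_logGamma_term s), tsum_congr (hterm s hs)]
    simp
  have hsumm : ∀ s ∈ gammaCell m, Summable fun k : ℕ =>
      (Real.log (s + (k + 1 : ℕ)) - Real.log ((k : ℝ) + 1) - s / ((k : ℝ) + 1)) := by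
    intro s hs
    exact (Complex.hasSum_re (summable_logGamma_term s).hasSum).summable.congr (hterm s hs)
  refine ⟨hconv, fun a ha b hb hab p q hp hq hpq => ?_⟩
  have hc := hconv ha hb hp.le hq.le hpq
  simp only [smul_eq_mul] at hc ⊢
  rw [hform a ha, hform b hb, hform _ hc]
  have hle : p * ∑' k : ℕ, (Real.log (a + (k + 1 : ℕ)) - Real.log ((k : ℝ) + 1) -
        a / ((k : ℝ) + 1)) +
      q * ∑' k : ℕ, (Real.log (b + (k + 1 : ℕ)) - Real.log ((k : ℝ) + 1) - b / ((k : ℝ) + 1)) ≤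
      ∑' k : ℕ, (Real.log (p * a + q * b + (k + 1 : ℕ)) - Real.log ((k : ℝ) + 1) -
        (p * a + q * b) / ((k : ℝ) + 1)) := by
    rw [← tsum_mul_left, ← tsum_mul_left,
      ← ((hsumm a ha).mul_left p).tsum_add ((hsumm b hb).mul_left q)]
    refine (((hsumm a ha).mul_left p).add ((hsumm b hb).mul_left q)).tsum_le_tsum
      (fun k => ?_) (hsumm _ hc)
    have h := hshift (k + 1) a ha b hb hab p q hp hq hpq
    have hlin : p * (Real.log ((k : ℝ) + 1)) + q * (Real.log ((k : ℝ) + 1)) =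
      Real.log ((k : ℝ) + 1) := by rw [← add_mul, hpq, one_mul]
    have hdiv : (p * a + q * b) / ((k : ℝ) + 1) =
      p * (a / ((k : ℝ) + 1)) + q * (b / ((k : ℝ) + 1)) := by ring
    rw [hdiv]
    linarith
  have h0 := hshift 0 a ha b hb hab p q hp hq hpq
  simp only [Nat.cast_zero, add_zero] at h0
  linarith

theorem hasDerivAt_log_Gamma {m : ℕ} {s : ℝ} (hs : s ∈ gammaCell m) :
    HasDerivAt (fun s => Real.log (Real.Gamma s)) (deriv Real.Gamma s / Real.Gamma s) s :=
  (Real.differentiableAt_Gamma (ne_neg_of_mem_gammaCell hs)).hasDerivAt.log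
    (Real.Gamma_ne_zero (ne_neg_of_mem_gammaCell hs))

theorem deriv_log_Gamma_strictMono {m : ℕ} {a b : ℝ} (ha : a ∈ gammaCell m)
    (hb : b ∈ gammaCell m) (hab : a < b) :
    deriv Real.Gamma a / Real.Gamma a < deriv Real.Gamma b / Real.Gamma b :=
  ((strictConvexOn_log_Gamma_gammaCell m).lt_slope_of_hasDerivAt ha hb hab
    (hasDerivAt_log_Gamma ha)).trans
  ((strictConvexOn_log_Gamma_gammaCell m).slope_lt_of_hasDerivAt ha hb hab
    (hasDerivAt_log_Gamma hb))

theorem neg_one_pow_mul_deriv_Gamma_pos {m : ℕ} {c s : ℝ} (hc : c ∈ gammaCell m)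
    (hs : s ∈ gammaCell m) (hc0 : deriv Real.Gamma c = 0) (hcs : c < s) :
    0 < (-1 : ℝ) ^ m * deriv Real.Gamma s := by
  have h := deriv_log_Gamma_strictMono hc hs hcs
  rw [hc0, zero_div] at h
  have hpos := mul_pos (neg_one_pow_mul_Gamma_pos hs) h
  rwa [mul_assoc, mul_div_cancel₀ _ (Real.Gamma_ne_zero (ne_neg_of_mem_gammaCell hs))] at hpos

theorem neg_one_pow_mul_deriv_Gamma_neg {m : ℕ} {c s : ℝ} (hc : c ∈ gammaCell m)
    (hs : s ∈ gammaCell m) (hc0 : deriv Real.Gamma c = 0) (hcs : s < c) :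
    (-1 : ℝ) ^ m * deriv Real.Gamma s < 0 := by
  have h := deriv_log_Gamma_strictMono hs hc hcs
  rw [hc0, zero_div] at h
  have hpos := mul_neg_of_pos_of_neg (neg_one_pow_mul_Gamma_pos hs) h
  rwa [mul_assoc, mul_div_cancel₀ _ (Real.Gamma_ne_zero (ne_neg_of_mem_gammaCell hs))] at hpos

theorem continuous_inv_Gamma : Continuous fun s : ℝ => (Real.Gamma s)⁻¹ := by
  have h := Complex.continuous_re.comp
    (Complex.differentiable_one_div_Gamma.continuous.comp Complex.continuous_ofReal)
  refine h.congr fun s => ?_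
  simp only [Function.comp_apply, Complex.Gamma_ofReal, ← Complex.ofReal_inv, Complex.ofReal_re]

theorem exists_mul_Gamma_eq {ε p b τ : ℝ} (hb : Real.Gamma b = 0) (hp : 0 < ε * Real.Gamma p)
    (hτ : ε * Real.Gamma p < τ) :
    ∃ s ∈ Set.uIcc p b, s ≠ p ∧ s ≠ b ∧ ε * Real.Gamma s = τ := by
  have hcont : Continuous fun s : ℝ => (ε * Real.Gamma s)⁻¹ := by
    simpa only [mul_inv] using continuous_inv_Gamma.const_mul ε⁻¹
  have hτ0 : 0 < τ := hp.trans hτ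
  have hmem : τ⁻¹ ∈ Set.uIcc (ε * Real.Gamma p)⁻¹ (ε * Real.Gamma b)⁻¹ := by
    rw [hb, mul_zero, inv_zero, Set.uIcc_of_ge (inv_pos.2 hp).le]
    exact ⟨(inv_pos.2 hτ0).le, inv_anti₀ hp hτ.le⟩
  obtain ⟨s, hs, hsτ⟩ := intermediate_value_uIcc hcont.continuousOn hmem
  have hsτ' : ε * Real.Gamma s = τ := inv_injective hsτ
  refine ⟨s, hs, ?_, ?_, hsτ'⟩
  · rintro rfl
    exact hτ.ne hsτ'
  · rintro rfl
    rw [hb, mul_zero] at hsτ'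
    exact hτ0.ne hsτ'

theorem Ik_eq (x : ℕ → ℝ) (k : ℕ) :
    Ik x k = Set.Icc ((-1) ^ (k + 1) * Real.Gamma (x k))
      ((-1) ^ (k + 1) * Real.Gamma (x (k + 1))) := by
  unfold Ik
  split_ifs with h
  · rw [h.add_one.neg_one_pow, one_mul, one_mul]
  · rw [(Nat.not_odd_iff_even.1 h).add_one.neg_one_pow, neg_one_mul, neg_one_mul]

/-- Every real point off `[(-1)^{k+1} Γ(a), (-1)^{k+1} Γ(b)]`, with `a`, `b` the critical points
of `Γ` on either side of `-k`, is a noncritical value of `(-1)^{k+1} Γ` on the real axis, taken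
where the boundary value of `logGamma` matches `log`. -/
theorem exists_real_preimage {k : ℕ} {a b : ℝ} (ha : a ∈ gammaCell k) (hb : b ∈ gammaCell (k + 1))
    (ha0 : deriv Real.Gamma a = 0) (hb0 : deriv Real.Gamma b = 0) {t : ℝ}
    (ht : t ∉ Set.Icc ((-1) ^ (k + 1) * Real.Gamma a) ((-1) ^ (k + 1) * Real.Gamma b)) :
    ∃ m : ℕ, ∃ s ∈ gammaCell m, t ≠ 0 ∧ (-1) ^ (k + 1) * Real.Gamma s = t ∧
      0 < (-1) ^ (k + 1) * deriv Real.Gamma s ∧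
      logGamma s = Complex.log t - ((k : ℂ) + 1) * Real.pi * I := by
  have hpole : Real.Gamma (-(k : ℝ)) = 0 := Real.Gamma_neg_nat_eq_zero k
  have hapos := neg_one_pow_mul_Gamma_pos ha
  have hbpos := neg_one_pow_mul_Gamma_pos hb
  have hak : -(k : ℝ) < a := by linarith [ha.2]
  have hbk : b < -(k : ℝ) := by linarith [hb.1 k k.lt_succ_self]
  have habs : ∀ {m : ℕ} {s τ : ℝ}, (-1) ^ m * Real.Gamma s = τ →
      Real.log (Real.Gamma s) = Real.log τ := by
    rintro m s τ rfl
    rw [← Real.log_abs, ← Real.log_abs ((-1) ^ m * _), abs_mul, abs_pow]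
    simp
  rw [Set.mem_Icc, not_and_or, not_le, not_le] at ht
  rcases ht with ht | ht
  · have hlt : (-1) ^ k * Real.Gamma a < -t := by
      rw [pow_succ] at ht
      linarith
    obtain ⟨s, hs, hsa, hsk, hst⟩ := exists_mul_Gamma_eq hpole hapos hlt
    rw [Set.uIcc_of_ge hak.le] at hs
    have hks : -(k : ℝ) < s := lt_of_le_of_ne hs.1 (Ne.symm hsk)
    have hsc : s ∈ gammaCell k :=
      ⟨fun j hj => by linarith [ha.1 j hj, hs.2], by linarith⟩
    have htneg : t < 0 := by linarith
    refine ⟨k, s, hsc, htneg.ne, ?_, ?_, ?_⟩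
    · rw [pow_succ]; linarith
    · have := neg_one_pow_mul_deriv_Gamma_neg ha hsc ha0 (lt_of_le_of_ne hs.2 hsa)
      rw [pow_succ]; linarith
    · have hre := (logGamma_re_of_mem_gammaCell hsc).trans (habs hst)
      rw [Real.log_neg_eq_log] at hre
      apply Complex.ext
      · simp [hre, Complex.log_ofReal_re]
      · simp [logGamma_im_of_mem_gammaCell hsc, Complex.log_im, Complex.arg_ofReal_of_neg htneg]
        ring
  · obtain ⟨s, hs, hsb, hsk, hst⟩ := exists_mul_Gamma_eq hpole hbpos ht
    rw [Set.uIcc_of_le hbk.le] at hs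
    have hks : s < -(k : ℝ) := lt_of_le_of_ne hs.2 hsk
    have hsc : s ∈ gammaCell (k + 1) := by
      refine ⟨fun j hj => ?_, by linarith [hb.2, hs.1]⟩
      have : (j : ℝ) ≤ k := by exact_mod_cast Nat.lt_succ_iff.1 hj
      linarith
    have htpos : 0 < t := hbpos.trans ht
    refine ⟨k + 1, s, hsc, htpos.ne', hst, ?_, ?_⟩
    · exact neg_one_pow_mul_deriv_Gamma_pos hb hsc hb0 (lt_of_le_of_ne hs.1 (Ne.symm hsb))
    · have hre := (logGamma_re_of_mem_gammaCell hsc).trans (habs hst)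
      apply Complex.ext
      · simp [hre, Complex.log_ofReal_re]
      · simp [logGamma_im_of_mem_gammaCell hsc, Complex.log_im,
          Complex.arg_ofReal_of_nonneg htpos.le]

/-- A holomorphic function on a disc centred on the real axis which is real on the real axis and
whose derivative has positive real part preserves the upper half plane. -/
theorem im_pos_of_re_deriv_pos {h : ℂ → ℂ} {t r : ℝ}
    (hd : ∀ z ∈ Metric.ball (t : ℂ) r, DifferentiableAt ℂ h z)
    (hpos : ∀ z ∈ Metric.ball (t : ℂ) r, 0 < (deriv h z).re)
    (hreal : ∀ u : ℝ, (u : ℂ) ∈ Metric.ball (t : ℂ) r → (h u).im = 0)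
    {z : ℂ} (hz : z ∈ Metric.ball (t : ℂ) r) (hzim : 0 < z.im) : 0 < (h z).im := by
  have hmem : ∀ v ∈ Set.Icc 0 z.im, (z.re : ℂ) + (v : ℂ) * I ∈ Metric.ball (t : ℂ) r := by
    intro v hv
    rw [Metric.mem_ball, Complex.dist_eq] at hz ⊢
    refine lt_of_le_of_lt ?_ hz
    rw [Complex.norm_def, Complex.norm_def]
    apply Real.sqrt_le_sqrt
    simp only [Complex.normSq_apply, sub_re, add_re, ofReal_re, mul_re, I_re, mul_zero, ofReal_im,
      I_im, mul_one, sub_im, add_im, mul_im, sub_self, add_zero, zero_add, sub_zero]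
    nlinarith [hv.1, hv.2]
  have hder : ∀ v ∈ Set.Icc 0 z.im, HasDerivAt
      (fun v : ℝ => (h ((z.re : ℂ) + (v : ℂ) * I)).im)
      (deriv h ((z.re : ℂ) + (v : ℂ) * I)).re v := by
    intro v hv
    have h1 : HasDerivAt (fun v : ℝ => (z.re : ℂ) + (v : ℂ) * I) I v := by
      simpa using (((hasDerivAt_id v).ofReal_comp).mul_const I).const_add (z.re : ℂ)
    have h2 := (hd _ (hmem v hv)).hasDerivAt.comp v h1
    have h3 := Complex.imCLM.hasFDerivAt.comp_hasDerivAt v h2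
    rw [imCLM_apply, mul_I_im] at h3
    exact h3
  have hmono : StrictMonoOn (fun v : ℝ => (h ((z.re : ℂ) + (v : ℂ) * I)).im)
      (Set.Icc 0 z.im) := by
    refine strictMonoOn_of_deriv_pos (convex_Icc _ _)
      (fun v hv => (hder v hv).continuousAt.continuousWithinAt) fun v hv => ?_
    rw [(hder v (interior_subset hv)).deriv]
    exact hpos _ (hmem v (interior_subset hv))
  have hlt := hmono (Set.left_mem_Icc.2 hzim.le) (Set.right_mem_Icc.2 hzim.le) hzim
  have h0 := hreal z.re (by simpa using hmem 0 (Set.left_mem_Icc.2 hzim.le))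
  simpa [h0, Complex.re_add_im] using hlt

/-- A holomorphic function commuting with conjugation and with positive derivative at a real point
has a local inverse there which commutes with conjugation and preserves the upper half plane. -/
theorem exists_real_local_inverse {F : ℂ → ℂ} {s : ℝ} (hF : AnalyticAt ℂ F s)
    (hconj : ∀ z, F (starRingEnd ℂ z) = starRingEnd ℂ (F z)) {t d : ℝ} (hst : F s = t)
    (hd : 0 < d) (hder : deriv F s = d) :
    ∃ h : ℂ → ℂ, AnalyticAt ℂ h t ∧ h t = s ∧ ∃ r > 0, ∀ z ∈ Metric.ball (t : ℂ) r,
      DifferentiableAt ℂ h z ∧ F (h z) = z ∧ h (starRingEnd ℂ z) = starRingEnd ℂ (h z) ∧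
      (0 < z.im → 0 < (h z).im) := by
  have hd' : deriv F s ≠ 0 := by
    rw [hder]
    exact_mod_cast hd.ne'
  have hstrict := hF.hasStrictDerivAt
  obtain ⟨h, hh⟩ : ∃ h, h = HasStrictDerivAt.localInverse F _ _ hstrict hd' := ⟨_, rfl⟩
  have hana : AnalyticAt ℂ h t := by
    rw [hh, ← hst]
    exact hF.analyticAt_localInverse hd'
  have hright : ∀ᶠ z in 𝓝 (t : ℂ), F (h z) = z := by
    rw [hh, ← hst]
    exact hstrict.eventually_right_inverse hd'
  have hleft : ∀ᶠ w in 𝓝 (s : ℂ), h (F w) = w := by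
    rw [hh]
    exact hstrict.eventually_left_inverse hd'
  have hts : h t = s := by
    rw [← hst]
    exact hleft.self_of_nhds
  have hderiv : deriv h t = ((d⁻¹ : ℝ) : ℂ) := by
    have h1 := (hstrict.to_localInverse hd').hasDerivAt.deriv
    rw [← hh, hst, hder] at h1
    rw [h1, ofReal_inv]
  have hcont : Tendsto (fun z => starRingEnd ℂ (h z)) (𝓝 (t : ℂ)) (𝓝 (s : ℂ)) := by
    have h1 := (Complex.continuous_conj.tendsto (h t)).comp hana.continuousAt.tendsto
    rwa [hts, Complex.conj_ofReal] at h1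
  have hpos : ∀ᶠ z in 𝓝 (t : ℂ), 0 < (deriv h z).re := by
    refine (Complex.continuous_re.continuousAt.comp hana.deriv.continuousAt).eventually_const_lt ?_
    rw [Function.comp_apply, hderiv, ofReal_re]
    exact inv_pos.2 hd
  obtain ⟨r, hr, hball⟩ := Metric.eventually_nhds_iff_ball.1
    (hana.eventually_analyticAt.and (hright.and ((hcont.eventually hleft).and hpos)))
  have hsymm : ∀ z ∈ Metric.ball (t : ℂ) r, h (starRingEnd ℂ z) = starRingEnd ℂ (h z) := by
    intro z hz
    have h1 := (hball z hz).2.2.1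
    rwa [hconj, (hball z hz).2.1] at h1
  refine ⟨h, hana, hts, r, hr, fun z hz => ⟨(hball z hz).1.differentiableAt, (hball z hz).2.1,
    hsymm z hz, im_pos_of_re_deriv_pos (fun w hw => (hball w hw).1.differentiableAt)
      (fun w hw => (hball w hw).2.2.2) (fun u hu => ?_) hz⟩⟩
  have h1 := hsymm u hu
  rw [Complex.conj_ofReal] at h1
  exact Complex.conj_eq_iff_im.1 h1.symm

/-- Two logarithms of the same function with a common limit agree near the limit point. -/
theorem eventually_eq_of_exp_eq {α : Type*} {l : Filter α} {u v : α → ℂ} {c : ℂ}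
    (hu : Tendsto u l (𝓝 c)) (hv : Tendsto v l (𝓝 c))
    (huv : ∀ᶠ z in l, Complex.exp (u z) = Complex.exp (v z)) : ∀ᶠ z in l, u z = v z := by
  have hsub : Tendsto (fun z => ‖u z - v z‖) l (𝓝 0) := by
    simpa using (hu.sub hv).norm
  filter_upwards [huv, hsub.eventually_lt_const (mul_pos two_pos Real.pi_pos)] with z hz hlt
  obtain ⟨n, hn⟩ := Complex.exp_eq_exp_iff_exists_int.1 hz
  rw [hn, add_sub_cancel_left, norm_mul, Complex.norm_intCast] at hlt
  have h2 : ‖(2 * Real.pi * I : ℂ)‖ = 2 * Real.pi := by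
    simp [abs_of_pos Real.pi_pos]
  rw [h2] at hlt
  have hlt1 : |(n : ℝ)| < 1 := by
    by_contra hge
    nlinarith [Real.pi_pos, not_lt.1 hge]
  have hn0 : n = 0 := Int.abs_lt_one_iff.1 (by exact_mod_cast hlt1)
  simpa [hn0] using hn

theorem exists_local_extension {k : ℕ} {g : ℂ → ℂ} (hgim : ∀ z : ℂ, 0 < z.im → 0 < (g z).im)
    (hgL : ∀ z : ℂ, 0 < z.im →
      logGamma (g z) = Complex.log z - ((k : ℂ) + 1) * Real.pi * I)
    {m : ℕ} {s t : ℝ} (hs : s ∈ gammaCell m) (ht : t ≠ 0)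
    (hst : (-1) ^ (k + 1) * Real.Gamma s = t) (hder : 0 < (-1) ^ (k + 1) * deriv Real.Gamma s)
    (hL : logGamma s = Complex.log t - ((k : ℂ) + 1) * Real.pi * I) :
    ∃ h : ℂ → ℂ, ∃ r > 0, ∀ z ∈ Metric.ball (t : ℂ) r,
      DifferentiableAt ℂ h z ∧ (-1) ^ (k + 1) * Complex.Gamma (h z) = z ∧
      h (starRingEnd ℂ z) = starRingEnd ℂ (h z) ∧ (0 < z.im → g z = h z) := by
  have hne := ofReal_ne_neg_of_mem_gammaCell hs
  have hdG : ∀ᶠ z in 𝓝 (s : ℂ), DifferentiableAt ℂ Complex.Gamma z := by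
    have h0 : (Complex.Gamma s)⁻¹ ≠ 0 := inv_ne_zero (Complex.Gamma_ne_zero hne)
    filter_upwards [Complex.differentiable_one_div_Gamma.continuous.continuousAt.eventually_ne h0]
      with z hz
    refine Complex.differentiableAt_Gamma z fun j hj => hz ?_
    rw [hj, Complex.Gamma_neg_nat_eq_zero, inv_zero]
  have hGana : AnalyticAt ℂ Complex.Gamma s :=
    DifferentiableOn.analyticAt (s := {z | DifferentiableAt ℂ Complex.Gamma z})
      (fun z hz => DifferentiableAt.differentiableWithinAt hz) hdG
  have hGderiv : deriv Complex.Gamma s = ((deriv Real.Gamma s : ℝ) : ℂ) := by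
    have h1 := hGana.differentiableAt.hasDerivAt.comp_ofReal
    have h2 := (Real.differentiableAt_Gamma (ne_neg_of_mem_gammaCell hs)).hasDerivAt.ofReal_comp
    simp only [Complex.Gamma_ofReal] at h1
    exact h1.unique h2
  obtain ⟨h, hana, hts, r, hr, hprop⟩ := exists_real_local_inverse
    (F := fun z => (-1) ^ (k + 1) * Complex.Gamma z) (t := t) (analyticAt_const.mul hGana)
    (fun z => by simp [Complex.Gamma_conj])
    (by rw [Complex.Gamma_ofReal]; exact_mod_cast hst) hder
    (by rw [deriv_const_mul _ hGana.differentiableAt, hGderiv]; push_cast; rfl)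
  have hball := Metric.ball_mem_nhds (t : ℂ) hr
  have hbase : ∀ᶠ z in 𝓝[{z : ℂ | 0 < z.im}] (t : ℂ), z ∈ Metric.ball (t : ℂ) r ∧ 0 < z.im :=
    Filter.Eventually.and (mem_nhdsWithin_of_mem_nhds hball) self_mem_nhdsWithin
  have hle : 𝓝[{z : ℂ | 0 < z.im}] (t : ℂ) ≤ 𝓝[{z : ℂ | 0 ≤ z.im}] (t : ℂ) :=
    nhdsWithin_mono _ fun z (hz : 0 < z.im) => hz.le
  have hlim : Tendsto (fun z => logGamma (h z)) (𝓝[{z : ℂ | 0 < z.im}] (t : ℂ))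
      (𝓝 (logGamma s)) := by
    refine (continuousWithinAt_logGamma hs).tendsto.comp (tendsto_nhdsWithin_iff.2 ⟨?_, ?_⟩)
    · have h1 := hana.continuousAt.tendsto
      rw [hts] at h1
      exact h1.mono_left nhdsWithin_le_nhds
    · filter_upwards [hbase] with z hz
      exact ((hprop z hz.1).2.2.2 hz.2).le
  have hlim' : Tendsto (fun z => Complex.log z - ((k : ℂ) + 1) * Real.pi * I)
      (𝓝[{z : ℂ | 0 < z.im}] (t : ℂ)) (𝓝 (logGamma s)) := by
    rw [hL]
    exact ((continuousWithinAt_log_ofReal ht).tendsto.mono_left hle).sub_const _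
  have hev : ∀ᶠ z in 𝓝[{z : ℂ | 0 < z.im}] (t : ℂ), g z = h z := by
    have heq := eventually_eq_of_exp_eq hlim hlim' (by
      filter_upwards [hbase] with z hz
      have hne : ∀ {w : ℂ}, 0 < w.im → ∀ j : ℕ, w ≠ -j := by
        rintro w hw j rfl
        simp at hw
      have hhim := (hprop z hz.1).2.2.2 hz.2
      have h1 := (hprop z hz.1).2.1
      rw [exp_logGamma (hne hhim), ← hgL z hz.2, exp_logGamma (hne (hgim z hz.2))]
      have h2 : (-1) ^ (k + 1) * Complex.Gamma (g z) = z := by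
        have hz0 : z ≠ 0 := by
          rintro rfl
          simpa using hz.2
        rw [← exp_logGamma (hne (hgim z hz.2)), hgL z hz.2, Complex.exp_sub,
          Complex.exp_log hz0]
        have hpi : Complex.exp (((k : ℂ) + 1) * Real.pi * I) = (-1) ^ (k + 1) := by
          rw [← Complex.exp_pi_mul_I, ← Complex.exp_nat_mul]
          push_cast
          ring_nf
        rw [hpi, mul_div_cancel₀]
        exact pow_ne_zero _ (by norm_num)
      exact mul_left_cancel₀ (pow_ne_zero (k + 1) (by norm_num : (-1 : ℂ) ≠ 0)) (h1.trans h2.symm))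
    filter_upwards [heq, hbase] with z hz hzb
    exact logGamma_injOn (hgim z hzb.2) ((hprop z hzb.1).2.2.2 hzb.2)
      ((hgL z hzb.2).trans hz.symm)
  obtain ⟨ρ, hρ, hρball⟩ := Metric.eventually_nhds_iff_ball.1 (eventually_nhdsWithin_iff.1 hev)
  refine ⟨h, min r ρ, lt_min hr hρ, fun z hz => ?_⟩
  have h1 := hprop z (Metric.ball_subset_ball (min_le_left _ _) hz)
  exact ⟨h1.1, h1.2.1, h1.2.2.1, hρball z (Metric.ball_subset_ball (min_le_right _ _) hz)⟩

theorem neBot_nhdsWithin_upperHalfPlane (u : ℝ) : (𝓝[{w : ℂ | 0 < w.im}] (u : ℂ)).NeBot := by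
  rw [← mem_closure_iff_nhdsWithin_neBot, Complex.closure_setOfPred_lt_im]
  simp

/-- A reflection principle: a holomorphic function on the upper half plane which near every point
of a real set extends to a holomorphic function commuting with conjugation extends to the
union of both half planes and that set. -/
theorem exists_reflection_extension {g : ℂ → ℂ} (hg : DifferentiableOn ℂ g {z : ℂ | 0 < z.im})
    {U : Set ℝ} (hloc : ∀ t ∈ U, ∃ h : ℂ → ℂ, ∃ r > 0, ∀ z ∈ Metric.ball (t : ℂ) r,
      DifferentiableAt ℂ h z ∧ h (starRingEnd ℂ z) = starRingEnd ℂ (h z) ∧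
      (0 < z.im → g z = h z)) :
    ∃ G : ℂ → ℂ, DifferentiableOn ℂ G {z : ℂ | z.im ≠ 0 ∨ z.re ∈ U} ∧
      Set.EqOn G g {z : ℂ | 0 < z.im} ∧
      (∀ z : ℂ, (z.im ≠ 0 ∨ z.re ∈ U) → G (starRingEnd ℂ z) = starRingEnd ℂ (G z)) ∧
      ∀ t ∈ U, Tendsto g (𝓝[{z : ℂ | 0 < z.im}] (t : ℂ)) (𝓝 (G t)) := by
  classical
  let G : ℂ → ℂ := fun z => if 0 < z.im then g z else
    if z.im < 0 then starRingEnd ℂ (g (starRingEnd ℂ z)) else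
      limUnder (𝓝[{w : ℂ | 0 < w.im}] z) g
  have hup : ∀ z : ℂ, 0 < z.im → G z = g z := fun z hz => if_pos hz
  have hlow : ∀ z : ℂ, z.im < 0 → G z = starRingEnd ℂ (g (starRingEnd ℂ z)) := fun z hz => by
    simp only [G, if_neg hz.not_gt, if_pos hz]
  have hlocal : ∀ t ∈ U, ∃ h : ℂ → ℂ, ∃ r > 0, ∀ z ∈ Metric.ball (t : ℂ) r,
      DifferentiableAt ℂ h z ∧ h (starRingEnd ℂ z) = starRingEnd ℂ (h z) ∧ G z = h z ∧
      (z.im = 0 → Tendsto g (𝓝[{w : ℂ | 0 < w.im}] z) (𝓝 (G z))) := by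
    intro t ht
    obtain ⟨h, r, hr, hprop⟩ := hloc t ht
    refine ⟨h, r, hr, fun z hz => ?_⟩
    have hreal : z.im = 0 → Tendsto g (𝓝[{w : ℂ | 0 < w.im}] z) (𝓝 (h z)) := by
      intro hz0
      refine ((hprop z hz).1.continuousAt.tendsto.mono_left nhdsWithin_le_nhds).congr' ?_
      filter_upwards [mem_nhdsWithin_of_mem_nhds (Metric.isOpen_ball.mem_nhds hz),
        self_mem_nhdsWithin] with w hw hw'
      exact ((hprop w hw).2.2 hw').symm
    have hGh : G z = h z := by
      rcases lt_trichotomy z.im 0 with hlt | heq | hgt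
      · have hzc : starRingEnd ℂ z ∈ Metric.ball (t : ℂ) r := by
          rw [Metric.mem_ball, Complex.dist_eq] at hz ⊢
          rwa [← Complex.conj_ofReal t, ← map_sub, Complex.norm_conj]
        rw [hlow z hlt, (hprop _ hzc).2.2 (by simpa using hlt), (hprop z hz).2.1,
          Complex.conj_conj]
      · have hzre : z = (z.re : ℂ) := Complex.ext (by simp) (by simp [heq])
        have := neBot_nhdsWithin_upperHalfPlane z.re
        rw [← hzre] at this
        have hG : G z = limUnder (𝓝[{w : ℂ | 0 < w.im}] z) g := by
          simp only [G, heq, lt_irrefl, if_false]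
        rw [hG]
        exact (hreal heq).limUnder_eq
      · rw [hup z hgt, (hprop z hz).2.2 hgt]
    exact ⟨(hprop z hz).1, (hprop z hz).2.1, hGh, fun hz0 => hGh ▸ hreal hz0⟩
  have hopen : IsOpen {z : ℂ | 0 < z.im} := isOpen_lt continuous_const Complex.continuous_im
  have hopen' : IsOpen {z : ℂ | z.im < 0} := isOpen_lt Complex.continuous_im continuous_const
  have hreal_eq : ∀ z : ℂ, z.im = 0 → z = (z.re : ℂ) := fun z hz =>
    Complex.ext (by simp) (by simp [hz])
  refine ⟨G, fun z hz => DifferentiableAt.differentiableWithinAt ?_, hup, fun z hz => ?_, ?_⟩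
  · rcases lt_trichotomy z.im 0 with hlt | heq | hgt
    · have hc : 0 < (starRingEnd ℂ z).im := by simpa using hlt
      have h1 := ((hg _ hc).differentiableAt (hopen.mem_nhds hc)).conj_conj
      rw [Complex.conj_conj] at h1
      refine h1.congr_of_eventuallyEq ?_
      filter_upwards [hopen'.mem_nhds hlt] with w hw
      exact hlow w hw
    · obtain ⟨h, r, hr, hprop⟩ := hlocal z.re (hz.resolve_left (not_not.2 heq))
      rw [← hreal_eq z heq] at hprop
      refine (hprop z (Metric.mem_ball_self hr)).1.congr_of_eventuallyEq ?_
      filter_upwards [Metric.ball_mem_nhds z hr] with w hw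
      exact (hprop w hw).2.2.1
    · refine ((hg z hgt).differentiableAt (hopen.mem_nhds hgt)).congr_of_eventuallyEq ?_
      filter_upwards [hopen.mem_nhds hgt] with w hw
      exact hup w hw
  · rcases lt_trichotomy z.im 0 with hlt | heq | hgt
    · rw [hup _ (by simpa using hlt), hlow z hlt, Complex.conj_conj]
    · obtain ⟨h, r, hr, hprop⟩ := hlocal z.re (hz.resolve_left (not_not.2 heq))
      rw [← hreal_eq z heq] at hprop
      have h1 := hprop z (Metric.mem_ball_self hr)
      rw [Complex.conj_eq_iff_im.2 heq] at h1 ⊢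
      rw [h1.2.2.1, ← h1.2.1]
    · rw [hlow _ (by simpa using hgt), hup z hgt, Complex.conj_conj]
  · intro t ht
    obtain ⟨h, r, hr, hprop⟩ := hlocal t ht
    exact (hprop t (Metric.mem_ball_self hr)).2.2.2 (by simp)

/-- For every `k ≥ 0` the function `g_k` extends to a holomorphic
function `G_k` on `ℂ ∖ I_k` with `G_k(conj z) = conj (G_k z)` and
`Γ(G_k(x)) = (−1)^{k+1} x` for real `x ∉ I_k`. -/
theorem exists_extension_Gk (x : ℕ → ℝ)
    (hx0 : x 0 ∈ Set.Ioi (0 : ℝ) ∧ deriv Real.Gamma (x 0) = 0)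
    (hxk : ∀ j : ℕ, 1 ≤ j → x j ∈ Set.Ioo (-(j : ℝ)) (-(j : ℝ) + 1) ∧
      deriv Real.Gamma (x j) = 0)
    (k : ℕ) (g : ℂ → ℂ)
    (hg : DifferentiableOn ℂ g {z : ℂ | 0 < z.im})
    (hgim : ∀ z : ℂ, 0 < z.im → 0 < (g z).im)
    (hgL : ∀ z : ℂ, 0 < z.im →
      logGamma (g z) = Complex.log z - ((k : ℂ) + 1) * Real.pi * I) :
    ∃ G : ℂ → ℂ,
      DifferentiableOn ℂ G {z : ℂ | z.im ≠ 0 ∨ z.re ∉ Ik x k} ∧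
      Set.EqOn G g {z : ℂ | 0 < z.im} ∧
      (∀ z : ℂ, (z.im ≠ 0 ∨ z.re ∉ Ik x k) →
        G (starRingEnd ℂ z) = starRingEnd ℂ (G z)) ∧
      (∀ t : ℝ, t ∉ Ik x k → Complex.Gamma (G (t : ℂ)) = (-1 : ℂ) ^ (k + 1) * t) := by
  have hcell : ∀ j : ℕ, x j ∈ gammaCell j ∧ deriv Real.Gamma (x j) = 0 := by
    intro j
    rcases Nat.eq_zero_or_pos j with rfl | hj
    · exact ⟨⟨fun i hi => absurd hi i.not_lt_zero, by simpa using hx0.1⟩, hx0.2⟩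
    · obtain ⟨⟨h1, h2⟩, h3⟩ := hxk j hj
      refine ⟨⟨fun i hi => ?_, by linarith⟩, h3⟩
      have : (i : ℝ) + 1 ≤ j := by exact_mod_cast hi
      linarith
  have hloc : ∀ t ∈ (Ik x k)ᶜ, ∃ h : ℂ → ℂ, ∃ r > 0, ∀ z ∈ Metric.ball (t : ℂ) r,
      DifferentiableAt ℂ h z ∧ (-1) ^ (k + 1) * Complex.Gamma (h z) = z ∧
      h (starRingEnd ℂ z) = starRingEnd ℂ (h z) ∧ (0 < z.im → g z = h z) := by
    intro t ht
    rw [Set.mem_compl_iff, Ik_eq] at ht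
    obtain ⟨m, s, hs, ht0, hst, hder, hL⟩ := exists_real_preimage (hcell k).1 (hcell (k + 1)).1
      (hcell k).2 (hcell (k + 1)).2 ht
    exact exists_local_extension hgim hgL hs ht0 hst hder hL
  obtain ⟨G, hGd, hGg, hGconj, hGlim⟩ := exists_reflection_extension hg (U := (Ik x k)ᶜ)
    fun t ht => by
      obtain ⟨h, r, hr, hprop⟩ := hloc t ht
      exact ⟨h, r, hr, fun z hz => ⟨(hprop z hz).1, (hprop z hz).2.2⟩⟩
  refine ⟨G, hGd, hGg, hGconj, fun t ht => ?_⟩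
  obtain ⟨h, r, hr, hprop⟩ := hloc t ht
  have hself := hprop t (Metric.mem_ball_self hr)
  have hlim : Tendsto g (𝓝[{z : ℂ | 0 < z.im}] (t : ℂ)) (𝓝 (h t)) := by
    refine (hself.1.continuousAt.tendsto.mono_left nhdsWithin_le_nhds).congr' ?_
    filter_upwards [mem_nhdsWithin_of_mem_nhds (Metric.ball_mem_nhds (t : ℂ) hr),
      self_mem_nhdsWithin] with z hz hz'
    exact ((hprop z hz).2.2.2 hz').symm
  have := neBot_nhdsWithin_upperHalfPlane t
  rw [tendsto_nhds_unique (hGlim t ht) hlim]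
  nth_rewrite 2 [← hself.2.1]
  rw [← mul_assoc, ← mul_pow]
  simp
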